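/- Fix a nonempty subset S ⊆ Fin K, and define q_S(λ) = (σ² + λ·D_S)/Pmax + ∑_{k∈S} h_k² and α_S(λ) = (1/Pmax)·( (∑_{k∈S} h_k)/q_S(λ) )². For any j ∈ Fin K and any λ with q_S(λ) > 0, the function g_j(λ) := ι_j(α_S(λ)) satisfies g_j(λ) = h_j²/b_j − (h_j/(b_j·∑_{k∈S} h_k))·q_S(λ). Moreover, if D_S > 0, then for every ε ∈ ℝ (with q_S(λ+ε) > 0), g_j(λ+ε) = g_j(λ) − C_j·ε where C_j = h_j·D_S/(b_j·Pmax·∑_{k∈S} h_k) > 0; in particular g_j is affine and strictly decreasing in λ. -/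

import Mathlib

open Finset

/-- The threshold function `ι_k(α)`. -/
noncomputable def iota (K : ℕ) (h b : Fin K → ℝ) (Pmax : ℝ)
    (k : Fin K) (α : ℝ) : ℝ :=
  (h k) ^ 2 / b k * (1 - 1 / (h k * Real.sqrt (α * Pmax)))

/-- The threshold `iota` evaluated at `α = (H / q)² / Pmax` is affine in `q`. -/
theorem iota_inv_mul_div_sq {K : ℕ} (h b : Fin K → ℝ) {Pmax H q : ℝ} (j : Fin K)
    (hh : h j ≠ 0) (hP : Pmax ≠ 0) (hH : 0 < H) (hq : 0 < q) :
    iota K h b Pmax j ((1 / Pmax) * (H / q) ^ 2) =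
      (h j) ^ 2 / b j - (h j / (b j * H)) * q := by
  have hs : Real.sqrt ((1 / Pmax) * (H / q) ^ 2 * Pmax) = H / q := by
    rw [show (1 / Pmax) * (H / q) ^ 2 * Pmax = (H / q) ^ 2 by field_simp]
    exact Real.sqrt_sq (div_pos hH hq).le
  rw [iota, hs]
  field_simp

theorem stmt_17 (K : ℕ) (hK : 1 ≤ K) (h b : Fin K → ℝ)
    (hh : ∀ k, 0 < h k) (hb : ∀ k, 0 < b k)
    (σ2 η Pmax : ℝ) (hσ : 0 < σ2) (hη : 0 < η) (hP : 0 < Pmax)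
    (S : Finset (Fin K)) (hSne : S.Nonempty) :
    let DS : ℝ := η - Pmax * ∑ k ∈ S, b k
    let q : ℝ → ℝ := fun lam => (σ2 + lam * DS) / Pmax + ∑ k ∈ S, (h k) ^ 2
    let αS : ℝ → ℝ := fun lam => (1 / Pmax) * ((∑ k ∈ S, h k) / q lam) ^ 2
    -- affine formula for g_j(λ) = ι_j(α_S(λ))
    (∀ (j : Fin K) (lam : ℝ), 0 < q lam →
      iota K h b Pmax j (αS lam) =
        (h j) ^ 2 / b j - (h j / (b j * ∑ k ∈ S, h k)) * q lam) ∧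
    -- shift identity and strict decrease when D_S > 0
    (0 < DS →
      (∀ (j : Fin K) (lam ε : ℝ), 0 < q lam → 0 < q (lam + ε) →
        iota K h b Pmax j (αS (lam + ε)) =
          iota K h b Pmax j (αS lam) -
            (h j * DS / (b j * Pmax * ∑ k ∈ S, h k)) * ε) ∧
      (∀ j : Fin K, 0 < h j * DS / (b j * Pmax * ∑ k ∈ S, h k)) ∧
      (∀ j : Fin K,
        StrictAntiOn (fun lam => iota K h b Pmax j (αS lam))
          {lam : ℝ | 0 < q lam})) := by
  intro DS q αS
  have hH : 0 < ∑ k ∈ S, h k := Finset.sum_pos (fun k _ => hh k) hSne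
  have hg : ∀ (j : Fin K) (lam : ℝ), 0 < q lam →
      iota K h b Pmax j (αS lam) =
        (h j) ^ 2 / b j - (h j / (b j * ∑ k ∈ S, h k)) * q lam :=
    fun j _ hq => iota_inv_mul_div_sq h b j (hh j).ne' hP.ne' hH hq
  have hshift : ∀ lam ε : ℝ, q (lam + ε) = q lam + DS / Pmax * ε := by
    intro lam ε
    simp only [q]
    ring
  refine ⟨hg, fun hDS => ?_⟩
  have hC : ∀ j : Fin K, 0 < h j * DS / (b j * Pmax * ∑ k ∈ S, h k) := fun j =>
    div_pos (mul_pos (hh j) hDS) (mul_pos (mul_pos (hb j) hP) hH)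
  have hstep : ∀ (j : Fin K) (lam ε : ℝ), 0 < q lam → 0 < q (lam + ε) →
      iota K h b Pmax j (αS (lam + ε)) =
        iota K h b Pmax j (αS lam) -
          (h j * DS / (b j * Pmax * ∑ k ∈ S, h k)) * ε := by
    intro j lam ε hq hq'
    rw [hg j _ hq', hg j _ hq, hshift]
    have hbj := (hb j).ne'
    field_simp
    ring
  refine ⟨hstep, hC, fun j x hx y hy hxy => ?_⟩
  have hyx := hstep j x (y - x) hx (by rwa [add_sub_cancel])
  rw [add_sub_cancel] at hyx
  have hpos := mul_pos (hC j) (sub_pos.mpr hxy)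
  simp only
  linarith
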